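/- arXiv:2603.08886 — 2 statements merged into one kernel-verified Lean document; each statement's English description precedes it below -/
import Mathlib

section
/- Let 𝒳 and 𝒴 be finite sets with |𝒳| = |𝒴|, let Q(y|x,y′) be a POST channel kernel, and suppose that for each y′ ∈ 𝒴 the channel transition matrix 𝑄^{(c)}_{y′} (with (y,x)-entry Q(y|x,y′)) is invertible with inverse G_{y′}. For n ≥ 1 and y_0 ∈ 𝒴, define the matrix 𝑄^{(n)}_{y_0}, with rows indexed by y^n ∈ 𝒴^n and columns by x^n ∈ 𝒳^n, by 𝑄^{(n)}_{y_0}(y^n, x^n) = ∏_{t=1}^n Q(y_t|x_t, y_{t−1}), and the matrix 𝐺^{(n)}_{y_0}, with rows indexed by x^n ∈ 𝒳^n and columns by y^n ∈ 𝒴^n, by 𝐺^{(n)}_{y_0}(x^n, y^n) = ∏_{t=1}^n G_{y_{t−1}}(x_t, y_t). Then 𝐺^{(n)}_{y_0} 𝑄^{(n)}_{y_0} = I and 𝑄^{(n)}_{y_0} 𝐺^{(n)}_{y_0} = I; that is, 𝐺^{(n)}_{y_0} = (𝑄^{(n)}_{y_0})^{−1}. -/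
open scoped BigOperators

noncomputable section

/-- `Q x y' y` represents the POST-channel transition kernel `Q(y | x, y')`. -/
def IsPOST {X Y : Type*} [Fintype X] [Fintype Y] (Q : X → Y → Y → ℝ) : Prop :=
  (∀ x y' y, 0 ≤ Q x y' y) ∧ ∀ x y', ∑ y : Y, Q x y' y = 1

/-- The state preceding time `t` in a length-`n` block with initial state `y0`. -/
def prevState {Y : Type*} (n : ℕ) (y0 : Y) (ys : Fin n → Y) (t : Fin n) : Y :=
  if (t : ℕ) = 0 then y0
  else ys ⟨(t : ℕ) - 1, lt_of_le_of_lt (Nat.sub_le _ _) t.isLt⟩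

theorem prevState_cons_succ {Y : Type*} (n : ℕ) (y0 y : Y) (ys : Fin n → Y) (t : Fin n) :
    prevState (n + 1) y0 (Fin.cons y ys : Fin (n + 1) → Y) t.succ = prevState n y ys t := by
  rcases t with ⟨t, ht⟩
  cases t with
  | zero => rfl
  | succ k => rfl

theorem nfold_sum {X Y : Type*} [Fintype Y] [DecidableEq X]
    (Q : X → Y → Y → ℝ) (G : Y → Matrix X Y ℝ)
    (h : ∀ y' a b, ∑ y, G y' a y * Q b y' y = if a = b then 1 else 0)
    (n : ℕ) : ∀ (y0 : Y) (a b : Fin n → X),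
    ∑ ys : Fin n → Y, (∏ t : Fin n, G (prevState n y0 ys t) (a t) (ys t)) *
      (∏ t : Fin n, Q (b t) (prevState n y0 ys t) (ys t)) = if a = b then 1 else 0 := by
  induction n with
  | zero =>
    intro y0 a b
    simp [Subsingleton.elim a b]
  | succ n ih =>
    intro y0 a b
    rw [← (Fin.consEquiv (fun _ : Fin (n + 1) => Y)).sum_comp, Fintype.sum_prod_type]
    have key : ∀ (y : Y) (ys : Fin n → Y),
        (∏ t : Fin (n + 1), G (prevState (n + 1) y0 (Fin.cons y ys : Fin (n + 1) → Y) t) (a t)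
          ((Fin.cons y ys : Fin (n + 1) → Y) t)) *
        (∏ t : Fin (n + 1), Q (b t) (prevState (n + 1) y0 (Fin.cons y ys : Fin (n + 1) → Y) t)
          ((Fin.cons y ys : Fin (n + 1) → Y) t)) =
        (G y0 (a 0) y * Q (b 0) y0 y) *
        ((∏ t : Fin n, G (prevState n y ys t) (a t.succ) (ys t)) *
          (∏ t : Fin n, Q (b t.succ) (prevState n y ys t) (ys t))) := by
      intro y ys
      have h0 : prevState (n + 1) y0 (Fin.cons y ys : Fin (n + 1) → Y) 0 = y0 := rfl
      rw [Fin.prod_univ_succ, Fin.prod_univ_succ]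
      simp only [prevState_cons_succ, h0, Fin.cons_zero, Fin.cons_succ]
      ring
    simp only [Fin.consEquiv, Equiv.coe_fn_mk, key, ← Finset.mul_sum]
    have ih' := fun y => ih y (fun t => a t.succ) (fun t => b t.succ)
    simp only [ih', ← Finset.sum_mul, h]
    have : a = b ↔ a 0 = b 0 ∧ (fun t : Fin n => a t.succ) = (fun t : Fin n => b t.succ) := by
      simp only [funext_iff, Fin.forall_fin_succ]
    by_cases h1 : a 0 = b 0 <;> by_cases h2 : (fun t : Fin n => a t.succ) = (fun t => b t.succ) <;>
      simp [this, h1, h2]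

/-- If every single-letter channel transition matrix `𝑄^{(c)}_{y'}`
of the POST channel is invertible with inverse `G_{y'}`, then for every `n` and `y₀`
the `n`-fold matrix with entries `∏_t G_{y_{t-1}}(x_t, y_t)` is a two-sided inverse of
the `n`-fold channel transition matrix `𝑄^{(n)}_{y₀}` with entries
`∏_t Q(y_t | x_t, y_{t-1})`. -/
theorem nfold_inverse
    {X Y : Type*} [Fintype X] [Fintype Y] [DecidableEq X] [DecidableEq Y]
    (hcard : Fintype.card X = Fintype.card Y)
    (Q : X → Y → Y → ℝ) (hQ : IsPOST Q)
    (G : Y → Matrix X Y ℝ)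
    (hG1 : ∀ y' : Y, G y' * Matrix.of (fun y x => Q x y' y) = 1)
    (hG2 : ∀ y' : Y, Matrix.of (fun y x => Q x y' y) * G y' = 1)
    (n : ℕ) (hn : 0 < n) (y0 : Y) :
    (Matrix.of (fun (xs : Fin n → X) (ys : Fin n → Y) =>
        ∏ t : Fin n, G (prevState n y0 ys t) (xs t) (ys t)) *
      Matrix.of (fun (ys : Fin n → Y) (xs : Fin n → X) =>
        ∏ t : Fin n, Q (xs t) (prevState n y0 ys t) (ys t)) = 1) ∧
    (Matrix.of (fun (ys : Fin n → Y) (xs : Fin n → X) =>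
        ∏ t : Fin n, Q (xs t) (prevState n y0 ys t) (ys t)) *
      Matrix.of (fun (xs : Fin n → X) (ys : Fin n → Y) =>
        ∏ t : Fin n, G (prevState n y0 ys t) (xs t) (ys t)) = 1) := by
  have h1 : ∀ y' a b, ∑ y, G y' a y * Q b y' y = if a = b then 1 else 0 := by
    intro y' a b
    have := congrFun (congrFun (hG1 y') a) b
    simpa [Matrix.mul_apply, Matrix.one_apply] using this
  have h2 : Matrix.of (fun (xs : Fin n → X) (ys : Fin n → Y) =>
        ∏ t : Fin n, G (prevState n y0 ys t) (xs t) (ys t)) *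
      Matrix.of (fun (ys : Fin n → Y) (xs : Fin n → X) =>
        ∏ t : Fin n, Q (xs t) (prevState n y0 ys t) (ys t)) = 1 := by
    ext a b
    rw [Matrix.mul_apply, Matrix.one_apply]
    exact nfold_sum Q G h1 n y0 a b
  refine ⟨h2, ?_⟩
  exact (Matrix.mul_eq_one_comm_of_card_eq _ _ _ (by simp [hcard])).mp h2
end
end

section
/- Let Q be a POST channel, and let P⁰ and P¹ both be maximizers of the optimization problem defining C*_f(Q). Then for every y′ ∈ 𝒴 such that both 𝒴-marginals P⁰_{Y′}(y′) > 0 and P¹_{Y′}(y′) > 0, the induced conditional output kernels coincide: ∑_x P⁰_{X|Y′}(x|y′) Q(y|x,y′) = ∑_x P¹_{X|Y′}(x|y′) Q(y|x,y′) for all y ∈ 𝒴. -/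
open scoped BigOperators

noncomputable section

/-- Conditional mutual information `I(A;B|C)` for a joint pmf `P` on finite types,
with the conventions `0 · log 0 = 0` (and division by zero equal to zero)
and natural logarithm. -/
def condMI {A B C : Type*} [Fintype A] [Fintype B] [Fintype C]
    (P : A → B → C → ℝ) : ℝ :=
  ∑ a : A, ∑ b : B, ∑ c : C,
    P a b c *
      Real.log ((P a b c * ∑ a' : A, ∑ b' : B, P a' b' c) /
        ((∑ b' : B, P a b' c) * (∑ a' : A, P a' b c)))

/-- A joint pmf `P(x, y')` on `X × Y`. -/
def IsJointPmf {X Y : Type*} [Fintype X] [Fintype Y] (P : X → Y → ℝ) : Prop :=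
  (∀ x y, 0 ≤ P x y) ∧ ∑ x : X, ∑ y : Y, P x y = 1

/-- The stationarity constraint `∑_{x,y'} P(x,y') Q(y|x,y') = ∑_x P(x,y)` for all `y`. -/
def StationaryFor {X Y : Type*} [Fintype X] [Fintype Y]
    (Q : X → Y → Y → ℝ) (P : X → Y → ℝ) : Prop :=
  ∀ y : Y, ∑ x : X, ∑ y' : Y, P x y' * Q x y' y = ∑ x : X, P x y

/-- `I(X;Y|Y')` computed under the joint law `P(x,y') Q(y|x,y')`. -/
def fbMI {X Y : Type*} [Fintype X] [Fintype Y]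
    (Q : X → Y → Y → ℝ) (P : X → Y → ℝ) : ℝ :=
  condMI (fun (x : X) (y : Y) (y' : Y) => P x y' * Q x y' y)

/-- `P` is a maximizer of the optimization problem defining `C*_f(Q)`. -/
def IsFbMaximizer {X Y : Type*} [Fintype X] [Fintype Y]
    (Q : X → Y → Y → ℝ) (P : X → Y → ℝ) : Prop :=
  IsJointPmf P ∧ StationaryFor Q P ∧
    ∀ P' : X → Y → ℝ, IsJointPmf P' → StationaryFor Q P' → fbMI Q P' ≤ fbMI Q P

/-- The feedback capacity functional `C*_f(Q)`. -/
def Cfstar {X Y : Type*} [Fintype X] [Fintype Y] (Q : X → Y → Y → ℝ) : ℝ :=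
  sSup {r : ℝ | ∃ P : X → Y → ℝ, IsJointPmf P ∧ StationaryFor Q P ∧ fbMI Q P = r}

/-- A joint pmf `P(x^n, y_0)` on `𝒳^n × 𝒴`. -/
def IsJointPmfN {X Y : Type*} [Fintype X] [Fintype Y] (n : ℕ)
    (P : (Fin n → X) → Y → ℝ) : Prop :=
  (∀ xs y0, 0 ≤ P xs y0) ∧ ∑ xs : Fin n → X, ∑ y0 : Y, P xs y0 = 1

/-- The induced joint law `P(x^n,y_0) ∏_{t=1}^n Q(y_t|x_t,y_{t-1})`. -/
def nLaw {X Y : Type*} [Fintype X] [Fintype Y]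
    (Q : X → Y → Y → ℝ) (n : ℕ) (P : (Fin n → X) → Y → ℝ) :
    (Fin n → X) → (Fin n → Y) → Y → ℝ :=
  fun xs ys y0 => P xs y0 * ∏ t : Fin n, Q (xs t) (prevState n y0 ys t) (ys t)

/-- `C_n(Q) = (1/n) max_{P_{X^n Y_0}} I(X^n; Y^n | Y_0)`. -/
def Cn {X Y : Type*} [Fintype X] [Fintype Y] (Q : X → Y → Y → ℝ) (n : ℕ) : ℝ :=
  sSup {r : ℝ | ∃ P : (Fin n → X) → Y → ℝ, IsJointPmfN n P ∧
    r = (1 / (n : ℝ)) * condMI (nLaw Q n P)}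

/-- A pmf on a finite set. -/
def IsPmf {X : Type*} [Fintype X] (p : X → ℝ) : Prop :=
  (∀ x, 0 ≤ p x) ∧ ∑ x : X, p x = 1

/-- The mutual information `I(X;Y)` across the memoryless channel `W` with input pmf `p`. -/
def mlMI {X Y : Type*} [Fintype X] [Fintype Y] (W : X → Y → ℝ) (p : X → ℝ) : ℝ :=
  ∑ x : X, ∑ y : Y, p x * W x y * Real.log (W x y / ∑ x' : X, p x' * W x' y)

/-- The conditional output kernel `P_{Y|Y'}(y|y') = ∑_x P_{X|Y'}(x|y') Q(y|x,y')`. -/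
def condOut {X Y : Type*} [Fintype X] [Fintype Y]
    (Q : X → Y → Y → ℝ) (P : X → Y → ℝ) (y' y : Y) : ℝ :=
  (∑ x : X, P x y' * Q x y' y) / (∑ x : X, P x y')

/-- The perspective function of `negMulLog`. -/
def gPersp (r w : ℝ) : ℝ := w * Real.negMulLog (r / w)

lemma gPersp_eq {r w : ℝ} (hw : w = 0 → r = 0) :
    gPersp r w = r * (Real.log w - Real.log r) := by
  unfold gPersp Real.negMulLog
  by_cases h : w = 0
  · simp [h, hw h]
  · by_cases hr : r = 0
    · simp [hr]
    · rw [Real.log_div hr h]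
      field_simp
      ring

lemma gPersp_strict {r0 r1 w0 w1 : ℝ} (hr0 : 0 ≤ r0) (hr1 : 0 ≤ r1) (hw0 : 0 < w0)
    (hw1 : 0 < w1) (hne : r0 / w0 ≠ r1 / w1) :
    gPersp r0 w0 + gPersp r1 w1 < 2 * gPersp ((r0 + r1) / 2) ((w0 + w1) / 2) := by
  have hs : 0 < w0 + w1 := by positivity
  have hx0 : r0 / w0 ∈ Set.Ici (0 : ℝ) := Set.mem_Ici.2 (by positivity)
  have hx1 : r1 / w1 ∈ Set.Ici (0 : ℝ) := Set.mem_Ici.2 (by positivity)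
  have ha : 0 < w0 / (w0 + w1) := by positivity
  have hb : 0 < w1 / (w0 + w1) := by positivity
  have hab : w0 / (w0 + w1) + w1 / (w0 + w1) = 1 := by field_simp
  have h := Real.strictConcaveOn_negMulLog.2 hx0 hx1 hne ha hb hab
  have e : (w0 / (w0 + w1)) • (r0 / w0) + (w1 / (w0 + w1)) • (r1 / w1)
      = ((r0 + r1) / 2) / ((w0 + w1) / 2) := by
    simp only [smul_eq_mul]
    field_simp
  rw [e] at h
  have h2 := mul_lt_mul_of_pos_left h hs
  have e2 : (w0 + w1) * ((w0 / (w0 + w1)) • Real.negMulLog (r0 / w0)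
      + (w1 / (w0 + w1)) • Real.negMulLog (r1 / w1)) = gPersp r0 w0 + gPersp r1 w1 := by
    simp only [smul_eq_mul, gPersp]
    field_simp
  rw [e2] at h2
  refine h2.trans_eq ?_
  simp only [gPersp]
  ring

lemma gPersp_half (r w : ℝ) : 2 * gPersp (r / 2) (w / 2) = gPersp r w := by
  simp only [gPersp]
  rw [div_div_div_cancel_right₀ (by norm_num)]
  ring

lemma gPersp_concave {r0 r1 w0 w1 : ℝ} (hr0 : 0 ≤ r0) (hr1 : 0 ≤ r1) (hw0 : 0 ≤ w0)
    (hw1 : 0 ≤ w1) (h0 : w0 = 0 → r0 = 0) (h1 : w1 = 0 → r1 = 0) :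
    gPersp r0 w0 + gPersp r1 w1 ≤ 2 * gPersp ((r0 + r1) / 2) ((w0 + w1) / 2) := by
  rw [gPersp_half]
  rcases hw0.eq_or_lt with h | h
  · rw [← h, h0 h.symm]; simp [gPersp]
  rcases hw1.eq_or_lt with h' | h'
  · rw [← h', h1 h'.symm]; simp [gPersp]
  by_cases hne : r0 / w0 = r1 / w1
  · have e : (r0 + r1) / (w0 + w1) = r1 / w1 := by
      rw [div_eq_div_iff (by positivity) (by positivity)] at *
      linarith
    simp only [gPersp]
    rw [e, hne]
    linarith
  · have := gPersp_strict hr0 hr1 h h' hne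
    rw [gPersp_half] at this
    exact this.le

lemma fbMI_eq {X Y : Type*} [Fintype X] [Fintype Y] (Q : X → Y → Y → ℝ) (hQ : IsPOST Q)
    (P : X → Y → ℝ) (hP : ∀ x y, 0 ≤ P x y) :
    fbMI Q P = (∑ x, ∑ y, ∑ y', P x y' * Q x y' y * Real.log (Q x y' y)) +
      ∑ y, ∑ y', gPersp (∑ x, P x y' * Q x y' y) (∑ x, P x y') := by
  have hsum : ∀ x y', ∑ y, P x y' * Q x y' y = P x y' := by
    intro x y'
    rw [← Finset.mul_sum, hQ.2, mul_one]
  have hg : ∀ y y', gPersp (∑ x, P x y' * Q x y' y) (∑ x, P x y')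
      = ∑ x, P x y' * Q x y' y *
        (Real.log (∑ x, P x y') - Real.log (∑ x, P x y' * Q x y' y)) := by
    intro y y'
    rw [gPersp_eq, Finset.sum_mul]
    intro h
    rw [Finset.sum_eq_zero_iff_of_nonneg (fun x _ => hP x y')] at h
    exact Finset.sum_eq_zero fun x hx => by rw [h x hx, zero_mul]
  have e2 : ∑ y, ∑ y', gPersp (∑ x, P x y' * Q x y' y) (∑ x, P x y') =
      ∑ x, ∑ y, ∑ y', P x y' * Q x y' y *
        (Real.log (∑ x, P x y') - Real.log (∑ x, P x y' * Q x y' y)) := by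
    simp only [hg]
    rw [Finset.sum_comm (s := (Finset.univ : Finset X))]
    exact Finset.sum_congr rfl fun y _ => Finset.sum_comm
  rw [e2]
  unfold fbMI condMI
  simp only [hsum, ← Finset.sum_add_distrib]
  refine Finset.sum_congr rfl fun x _ => Finset.sum_congr rfl fun y _ =>
    Finset.sum_congr rfl fun y' _ => ?_
  by_cases h : P x y' * Q x y' y = 0
  · simp [h]
  have hp : P x y' ≠ 0 := left_ne_zero_of_mul h
  have hq : Q x y' y ≠ 0 := right_ne_zero_of_mul h
  have hpp : 0 < P x y' := lt_of_le_of_ne (hP x y') hp.symm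
  have hw : 0 < ∑ x, P x y' := lt_of_lt_of_le hpp
    (Finset.single_le_sum (f := fun x => P x y') (fun x _ => hP x y') (Finset.mem_univ x))
  have hr : 0 < ∑ x, P x y' * Q x y' y :=
    lt_of_lt_of_le (mul_pos hpp (lt_of_le_of_ne (hQ.1 x y' y) hq.symm))
      (Finset.single_le_sum (f := fun x => P x y' * Q x y' y)
        (fun x _ => mul_nonneg (hP x y') (hQ.1 x y' y)) (Finset.mem_univ x))
  rw [Real.log_div (mul_ne_zero h hw.ne') (mul_ne_zero hp hr.ne'), Real.log_mul h hw.ne',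
    Real.log_mul hp hq, Real.log_mul hp hr.ne']
  ring

/-- Any two maximizers of the optimization problem defining
`C*_f(Q)` induce the same conditional output kernel at every state `y'` that both
maximizers charge with positive probability. -/
theorem maximizers_same_output_kernel
    {X Y : Type*} [Fintype X] [Fintype Y]
    (hX : 2 ≤ Fintype.card X) (hY : 2 ≤ Fintype.card Y)
    (Q : X → Y → Y → ℝ) (hQ : IsPOST Q)
    (P0 P1 : X → Y → ℝ)
    (h0 : IsFbMaximizer Q P0) (h1 : IsFbMaximizer Q P1) :
    ∀ y' : Y, 0 < ∑ x : X, P0 x y' → 0 < ∑ x : X, P1 x y' →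
      ∀ y : Y,
        (∑ x : X, (P0 x y' / ∑ x' : X, P0 x' y') * Q x y' y) =
          ∑ x : X, (P1 x y' / ∑ x' : X, P1 x' y') * Q x y' y := by
  intro y' hw0 hw1 y
  by_contra hne
  obtain ⟨⟨hp0, hs0⟩, hst0, hm0⟩ := h0
  obtain ⟨⟨hp1, hs1⟩, hst1, hm1⟩ := h1
  have heq : fbMI Q P0 = fbMI Q P1 :=
    le_antisymm (hm1 P0 ⟨hp0, hs0⟩ hst0) (hm0 P1 ⟨hp1, hs1⟩ hst1)
  have hlin : ∀ y y', ∑ x, (P0 x y' + P1 x y') / 2 * Q x y' y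
      = ((∑ x, P0 x y' * Q x y' y) + ∑ x, P1 x y' * Q x y' y) / 2 := by
    intro y y'
    rw [← Finset.sum_add_distrib, Finset.sum_div]
    exact Finset.sum_congr rfl fun x _ => by ring
  have hlin2 : ∀ y', ∑ x, (P0 x y' + P1 x y') / 2
      = ((∑ x, P0 x y') + ∑ x, P1 x y') / 2 := by
    intro y'
    rw [← Finset.sum_add_distrib, Finset.sum_div]
  have hpm : ∀ x y, 0 ≤ (P0 x y + P1 x y) / 2 := fun x y => by
    have := hp0 x y
    have := hp1 x y
    linarith
  have hle := hm0 (fun x y => (P0 x y + P1 x y) / 2) ⟨hpm, by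
      simp only [← Finset.sum_div, Finset.sum_add_distrib, hs0, hs1]; norm_num⟩ (by
      intro y
      have a := hst0 y
      have b := hst1 y
      rw [Finset.sum_comm] at a b ⊢
      simp only [hlin, hlin2]
      rw [← Finset.sum_div, Finset.sum_add_distrib, a, b])
  rw [fbMI_eq Q hQ _ hpm] at hle
  have e0 := fbMI_eq Q hQ P0 hp0
  have e1 := fbMI_eq Q hQ P1 hp1
  have hL : (∑ x, ∑ y, ∑ y', (P0 x y' + P1 x y') / 2 * Q x y' y * Real.log (Q x y' y))
      = ((∑ x, ∑ y, ∑ y', P0 x y' * Q x y' y * Real.log (Q x y' y)) +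
        ∑ x, ∑ y, ∑ y', P1 x y' * Q x y' y * Real.log (Q x y' y)) / 2 := by
    simp only [← Finset.sum_add_distrib, Finset.sum_div]
    refine Finset.sum_congr rfl fun x _ => Finset.sum_congr rfl fun y _ =>
      Finset.sum_congr rfl fun y' _ => by ring
  rw [hL] at hle
  simp only [hlin, hlin2] at hle
  have hr : ∀ (P : X → Y → ℝ), (∀ x y, 0 ≤ P x y) → ∀ y y', 0 ≤ ∑ x, P x y' * Q x y' y :=
    fun P hP y y' => Finset.sum_nonneg fun x _ => mul_nonneg (hP x y') (hQ.1 x y' y)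
  have hz : ∀ (P : X → Y → ℝ), (∀ x y, 0 ≤ P x y) → ∀ y y', ∑ x, P x y' = 0 →
      ∑ x, P x y' * Q x y' y = 0 := by
    intro P hP y y' h
    rw [Finset.sum_eq_zero_iff_of_nonneg (fun x _ => hP x y')] at h
    exact Finset.sum_eq_zero fun x hx => by rw [h x hx, zero_mul]
  have hc : ∀ y y', gPersp (∑ x, P0 x y' * Q x y' y) (∑ x, P0 x y')
      + gPersp (∑ x, P1 x y' * Q x y' y) (∑ x, P1 x y') ≤
      2 * gPersp (((∑ x, P0 x y' * Q x y' y) + ∑ x, P1 x y' * Q x y' y) / 2)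
        (((∑ x, P0 x y') + ∑ x, P1 x y') / 2) := fun y y' =>
    gPersp_concave (hr P0 hp0 y y') (hr P1 hp1 y y') (Finset.sum_nonneg fun x _ => hp0 x y')
      (Finset.sum_nonneg fun x _ => hp1 x y') (hz P0 hp0 y y') (hz P1 hp1 y y')
  have hs := gPersp_strict (hr P0 hp0 y y') (hr P1 hp1 y y') hw0 hw1 (by
    intro h
    apply hne
    rw [Finset.sum_div, Finset.sum_div] at h
    simpa only [div_mul_eq_mul_div] using h)
  have hlt := Finset.sum_lt_sum (s := (Finset.univ : Finset Y))
    (fun y _ => Finset.sum_le_sum (s := (Finset.univ : Finset Y)) fun y' _ => hc y y')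
    ⟨y, Finset.mem_univ y, Finset.sum_lt_sum (s := (Finset.univ : Finset Y))
      (fun y' _ => hc y y') ⟨y', Finset.mem_univ y', hs⟩⟩
  simp only [Finset.sum_add_distrib, ← Finset.mul_sum] at hlt
  linarith
end
end
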